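/- Let X (state space), M (latent space) and Y (proposal space) be measurable spaces, K a Markov kernel from X to M, ρ a probability measure on Y, T : Y → X a measurable map, and A ⊆ M × Y a measurable acceptance set. Define the Markov kernel Q on X by Q x (E) = ∫_M ∫_Y [ 1_A(m, y) · 1_E(T y) + (1 − 1_A(m, y)) · 1_E(x) ] dρ(y) d(K x)(m); that is, from state x one draws a latent m ~ K x and a proposal y ~ ρ, moves to T y if (m, y) ∈ A and stays at x otherwise. If δ := inf over x, x' ∈ X of ∫_M ∫_M ρ({y : (m, y) ∈ A and (m', y) ∈ A}) d(K x)(m) d(K x')(m') satisfies δ > 0, then dTV(Q x, Q x') ≤ 1 − δ for all x, x' ∈ X; consequently Q admits a unique stationary probability measure and the chain converges geometrically in total variation with per-step contraction factor 1 − δ. -/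

import Mathlib

open MeasureTheory ProbabilityTheory Classical

/-- Total variation distance between two measures:
`dTV μ ν = sup over measurable sets A of |μ(A) − ν(A)|`. -/
noncomputable def dTV {X : Type*} [MeasurableSpace X] (μ ν : Measure X) : ℝ :=
  ⨆ A : {A : Set X // MeasurableSet A}, |(μ A.1).toReal - (ν A.1).toReal|

section TotalVariation

variable {X : Type*} [MeasurableSpace X]

theorem dTV_nonneg (μ ν : Measure X) : 0 ≤ dTV μ ν :=
  Real.iSup_nonneg fun _ => abs_nonneg _

theorem dTV_le_of_forall {μ ν : Measure X} {c : ℝ}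
    (h : ∀ E, MeasurableSet E → |μ.real E - ν.real E| ≤ c) : dTV μ ν ≤ c :=
  haveI : Nonempty {A : Set X // MeasurableSet A} := ⟨⟨∅, .empty⟩⟩
  ciSup_le fun E => h E.1 E.2

theorem abs_measureReal_sub_le_one (μ ν : Measure X) [IsProbabilityMeasure μ]
    [IsProbabilityMeasure ν] (E : Set X) : |μ.real E - ν.real E| ≤ 1 := by
  have h₁ : μ.real E ≤ 1 := measureReal_le_one
  have h₂ : ν.real E ≤ 1 := measureReal_le_one
  have h₃ : 0 ≤ μ.real E := measureReal_nonneg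
  have h₄ : 0 ≤ ν.real E := measureReal_nonneg
  rw [abs_le]
  constructor <;> linarith

theorem abs_measureReal_sub_le_dTV (μ ν : Measure X) [IsProbabilityMeasure μ]
    [IsProbabilityMeasure ν] {E : Set X} (hE : MeasurableSet E) :
    |μ.real E - ν.real E| ≤ dTV μ ν :=
  le_ciSup (f := fun A : {A : Set X // MeasurableSet A} => |(μ A.1).toReal - (ν A.1).toReal|)
    ⟨1, by rintro _ ⟨A, rfl⟩; exact abs_measureReal_sub_le_one μ ν A.1⟩ ⟨E, hE⟩

theorem dTV_le_one (μ ν : Measure X) [IsProbabilityMeasure μ] [IsProbabilityMeasure ν] :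
    dTV μ ν ≤ 1 :=
  dTV_le_of_forall fun E _ => abs_measureReal_sub_le_one μ ν E

theorem dTV_comm (μ ν : Measure X) : dTV μ ν = dTV ν μ := by
  simp only [dTV, abs_sub_comm]

theorem dTV_triangle (μ ν π : Measure X) [IsProbabilityMeasure μ] [IsProbabilityMeasure ν]
    [IsProbabilityMeasure π] : dTV μ π ≤ dTV μ ν + dTV ν π :=
  dTV_le_of_forall fun E hE => (abs_sub_le _ (ν.real E) _).trans
    (add_le_add (abs_measureReal_sub_le_dTV μ ν hE) (abs_measureReal_sub_le_dTV ν π hE))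

theorem eq_of_dTV_le_zero {μ ν : Measure X} [IsProbabilityMeasure μ] [IsProbabilityMeasure ν]
    (h : dTV μ ν ≤ 0) : μ = ν := by
  ext E hE
  have h₀ := abs_nonpos_iff.1 ((abs_measureReal_sub_le_dTV μ ν hE).trans h)
  exact (measureReal_eq_measureReal_iff).1 (sub_eq_zero.1 h₀)

/-- The layer-cake bound for integrals of `[0, c]`-valued functions. -/
theorem integral_sub_le_mul_dTV (μ ν : Measure X) [IsProbabilityMeasure μ]
    [IsProbabilityMeasure ν] {f : X → ℝ} (hf : Measurable f) {c : ℝ} (hc : 0 ≤ c)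
    (hf₀ : ∀ x, 0 ≤ f x) (hfc : ∀ x, f x ≤ c) :
    ∫ x, f x ∂μ - ∫ x, f x ∂ν ≤ c * dTV μ ν := by
  have hint (π : Measure X) [IsProbabilityMeasure π] : Integrable f π :=
    .of_mem_Icc 0 c hf.aemeasurable (.of_forall fun x => ⟨hf₀ x, hfc x⟩)
  have hlev (π : Measure X) [IsProbabilityMeasure π] :
      IntegrableOn (fun t => π.real {a | t ≤ f a}) (Set.Ioc 0 c) := by
    have hanti : Antitone fun t => π.real {a | t ≤ f a} := fun s t hst =>
      measureReal_mono fun a (ha : t ≤ f a) => hst.trans ha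
    exact .of_mem_Icc 0 1 hanti.measurable.aemeasurable
      (.of_forall fun t => ⟨measureReal_nonneg, measureReal_le_one⟩)
  rw [(hint μ).integral_eq_integral_Ioc_meas_le (.of_forall hf₀) (.of_forall hfc),
    (hint ν).integral_eq_integral_Ioc_meas_le (.of_forall hf₀) (.of_forall hfc),
    ← integral_sub (hlev μ) (hlev ν)]
  calc ∫ t in Set.Ioc 0 c, (μ.real {a | t ≤ f a} - ν.real {a | t ≤ f a})
      ≤ ∫ _ in Set.Ioc 0 c, dTV μ ν :=
        integral_mono ((hlev μ).sub (hlev ν)) (integrable_const _) fun t =>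
          (le_abs_self _).trans (abs_measureReal_sub_le_dTV μ ν (hf measurableSet_Ici))
    _ = c * dTV μ ν := by simp [hc]

/-- The space of probability measures is complete in total variation. -/
theorem exists_isProbabilityMeasure_dTV_le (μ : ℕ → Measure X)
    [∀ n, IsProbabilityMeasure (μ n)] (b : ℕ → ℝ) (hb : Filter.Tendsto b .atTop (nhds 0))
    (hμ : ∀ n m, n ≤ m → dTV (μ n) (μ m) ≤ b n) :
    ∃ π : Measure X, IsProbabilityMeasure π ∧ ∀ n, dTV (μ n) π ≤ b n := by
  have hdist (n m : ℕ) (hnm : n ≤ m) (E : Set X) (hE : MeasurableSet E) :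
      |(μ n).real E - (μ m).real E| ≤ b n :=
    (abs_measureReal_sub_le_dTV _ _ hE).trans (hμ n m hnm)
  have hlim (E : Set X) : ∃ l : ℝ, MeasurableSet E →
      Filter.Tendsto (fun n => (μ n).real E) .atTop (nhds l) := by
    by_cases hE : MeasurableSet E
    · obtain ⟨l, hl⟩ := cauchySeq_tendsto_of_complete
        (cauchySeq_of_le_tendsto_0' (s := fun n => (μ n).real E) b
          (fun n m hnm => hdist n m hnm E hE) hb)
      exact ⟨l, fun _ => hl⟩
    · exact ⟨0, fun h => absurd h hE⟩
  choose L hL using hlim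
  have hL₀ (E : Set X) (hE : MeasurableSet E) : 0 ≤ L E :=
    ge_of_tendsto' (hL E hE) fun n => measureReal_nonneg
  have hLdist (n : ℕ) (E : Set X) (hE : MeasurableSet E) : |(μ n).real E - L E| ≤ b n :=
    le_of_tendsto ((hL E hE).const_sub _).abs
      (Filter.eventually_atTop.2 ⟨n, fun m hm => hdist n m hm E hE⟩)
  have hsum (f : ℕ → Set X) (hf : ∀ i, MeasurableSet (f i))
      (hd : Pairwise (Function.onFun Disjoint f)) :
      HasSum (fun i => L (f i)) (L (⋃ i, f i)) := by
    rw [hasSum_iff_tendsto_nat_of_nonneg fun i => hL₀ _ (hf i)]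
    have hfin (n k : ℕ) :
        (μ n).real (⋃ i ∈ Finset.range k, f i) = ∑ i ∈ Finset.range k, (μ n).real (f i) :=
      measureReal_biUnion_finset (fun i _ j _ hij => hd hij) fun i _ => hf i
    have hmeas (k : ℕ) : MeasurableSet (⋃ i ∈ Finset.range k, f i) :=
      Finset.measurableSet_biUnion _ fun i _ => hf i
    have hLfin (k : ℕ) :
        L (⋃ i ∈ Finset.range k, f i) = ∑ i ∈ Finset.range k, L (f i) := by
      refine tendsto_nhds_unique (hL _ (hmeas k)) ?_
      simp only [hfin]
      exact tendsto_finsetSum _ fun i _ => hL _ (hf i)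
    have hunif : TendstoUniformly (fun n k => ∑ i ∈ Finset.range k, (μ n).real (f i))
        (fun k => ∑ i ∈ Finset.range k, L (f i)) .atTop := by
      rw [Metric.tendstoUniformly_iff]
      intro ε hε
      filter_upwards [hb.eventually_lt_const hε] with n hn k
      rw [dist_comm, ← hfin, ← hLfin]
      exact (hLdist n _ (hmeas k)).trans_lt hn
    refine hunif.tendsto_of_eventually_tendsto (.of_forall fun n => ?_)
      (hL _ (MeasurableSet.iUnion hf))
    refine (hasSum_iff_tendsto_nat_of_nonneg (fun i => measureReal_nonneg) _).1 ?_
    have hne : ∑' i, μ n (f i) ≠ ⊤ := by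
      rw [← measure_iUnion hd hf]
      exact measure_ne_top _ _
    rw [measureReal_def, measure_iUnion hd hf, ENNReal.tsum_toReal_eq fun i => measure_ne_top _ _]
    exact (ENNReal.summable_toReal hne).hasSum
  have hL_empty : L ∅ = 0 :=
    tendsto_nhds_unique (hL ∅ .empty) (by simp)
  have hL_univ : L Set.univ = 1 :=
    tendsto_nhds_unique (hL _ .univ) (by simp)
  let π : Measure X := Measure.ofMeasurable (fun E _ => ENNReal.ofReal (L E))
    (by simp [hL_empty]) fun f hf hd => by
      rw [← (hsum f hf hd).tsum_eq,
        ENNReal.ofReal_tsum_of_nonneg (fun i => hL₀ _ (hf i)) (hsum f hf hd).summable]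
  have hπ (E : Set X) (hE : MeasurableSet E) : π E = ENNReal.ofReal (L E) :=
    Measure.ofMeasurable_apply E hE
  refine ⟨π, ⟨by simp [hπ _ .univ, hL_univ]⟩, fun n => dTV_le_of_forall fun E hE => ?_⟩
  rw [measureReal_def π, hπ E hE, ENNReal.toReal_ofReal (hL₀ E hE)]
  exact hLdist n E hE

end TotalVariation

section Dobrushin

variable {X : Type*} [MeasurableSpace X] (κ : Kernel X X) [IsMarkovKernel κ]

theorem measureReal_bind_kernel (μ : Measure X) [IsProbabilityMeasure μ] {E : Set X}
    (hE : MeasurableSet E) : (μ.bind κ).real E = ∫ x, (κ x).real E ∂μ := by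
  rw [measureReal_def, Measure.bind_apply hE κ.aemeasurable]
  exact (integral_toReal (κ.measurable_coe hE).aemeasurable
    (.of_forall fun x => measure_lt_top _ _)).symm

theorem dTV_bind_le [Nonempty X] {c : ℝ} (hκ : ∀ x x', dTV (κ x) (κ x') ≤ c) (μ ν : Measure X)
    [IsProbabilityMeasure μ] [IsProbabilityMeasure ν] :
    dTV (μ.bind κ) (ν.bind κ) ≤ c * dTV μ ν := by
  have hc : 0 ≤ c := by
    obtain ⟨x⟩ := ‹Nonempty X›
    exact (dTV_nonneg _ _).trans (hκ x x)
  have key (μ ν : Measure X) [IsProbabilityMeasure μ] [IsProbabilityMeasure ν] (E : Set X)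
      (hE : MeasurableSet E) : (μ.bind κ).real E - (ν.bind κ).real E ≤ c * dTV μ ν := by
    have hmeas : Measurable fun x => (κ x).real E := (κ.measurable_coe hE).ennreal_toReal
    have hbdd : BddBelow (Set.range fun x => (κ x).real E) :=
      ⟨0, by rintro _ ⟨x, rfl⟩; exact measureReal_nonneg⟩
    set a := ⨅ x, (κ x).real E with ha
    have hint (π : Measure X) [IsProbabilityMeasure π] : Integrable (fun x => (κ x).real E) π :=
      .of_mem_Icc 0 1 hmeas.aemeasurable
        (.of_forall fun x => ⟨measureReal_nonneg, measureReal_le_one⟩)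
    have hshift (π : Measure X) [IsProbabilityMeasure π] :
        ∫ x, ((κ x).real E - a) ∂π = ∫ x, (κ x).real E ∂π - a := by
      rw [integral_sub (hint π) (integrable_const a)]
      simp
    have h := integral_sub_le_mul_dTV μ ν (hmeas.sub_const a) hc
      (fun x => sub_nonneg.2 (ciInf_le hbdd x)) fun x => by
        have : (κ x).real E - c ≤ a := le_ciInf fun x' => by
          have := (le_abs_self _).trans
            ((abs_measureReal_sub_le_dTV (κ x) (κ x') hE).trans (hκ x x'))
          linarith
        linarith
    rw [hshift, hshift] at h
    rw [measureReal_bind_kernel κ μ hE, measureReal_bind_kernel κ ν hE]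
    linarith
  refine dTV_le_of_forall fun E hE => abs_sub_le_iff.2 ⟨key μ ν E hE, ?_⟩
  rw [dTV_comm]
  exact key ν μ E hE

instance isProbabilityMeasure_bind_iterate (μ : Measure X) [IsProbabilityMeasure μ] (n : ℕ) :
    IsProbabilityMeasure ((fun π : Measure X => π.bind κ)^[n] μ) := by
  induction n with
  | zero => assumption
  | succ n ih =>
    rw [Function.iterate_succ_apply']
    infer_instance

theorem dTV_bind_iterate_le [Nonempty X] {c : ℝ} (hκ : ∀ x x', dTV (κ x) (κ x') ≤ c)
    (μ ν : Measure X) [IsProbabilityMeasure μ] [IsProbabilityMeasure ν] (n : ℕ) :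
    dTV ((fun π : Measure X => π.bind κ)^[n] μ) ((fun π : Measure X => π.bind κ)^[n] ν) ≤
      c ^ n * dTV μ ν := by
  have hc : 0 ≤ c := by
    obtain ⟨x⟩ := ‹Nonempty X›
    exact (dTV_nonneg _ _).trans (hκ x x)
  induction n with
  | zero => simp
  | succ n ih =>
    rw [Function.iterate_succ_apply', Function.iterate_succ_apply', pow_succ', mul_assoc]
    exact (dTV_bind_le κ hκ _ _).trans (mul_le_mul_of_nonneg_left ih hc)

/-- A Markov kernel with Dobrushin coefficient less than `1` is uniquely ergodic and converges
geometrically in total variation. -/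
theorem exists_stationary_of_dTV_le [Nonempty X] {c : ℝ} (hc₁ : c < 1)
    (hκ : ∀ x x', dTV (κ x) (κ x') ≤ c) :
    ∃ π : Measure X, IsProbabilityMeasure π ∧ π.bind κ = π ∧
      (∀ ν : Measure X, IsProbabilityMeasure ν → ν.bind κ = ν → ν = π) ∧
      ∀ ν : Measure X, IsProbabilityMeasure ν → ∀ n : ℕ,
        dTV ((fun m : Measure X => m.bind κ)^[n] ν) π ≤ c ^ n * dTV ν π := by
  obtain ⟨x₀⟩ := id ‹Nonempty X›
  have hc : 0 ≤ c := (dTV_nonneg _ _).trans (hκ x₀ x₀)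
  have hpow : Filter.Tendsto (fun n : ℕ => c ^ n) .atTop (nhds 0) :=
    tendsto_pow_atTop_nhds_zero_of_lt_one hc hc₁
  let μ (n : ℕ) : Measure X := (fun m : Measure X => m.bind κ)^[n] (Measure.dirac x₀)
  have hprob (n : ℕ) : IsProbabilityMeasure (μ n) := isProbabilityMeasure_bind_iterate κ _ n
  obtain ⟨π, hπ, hμπ⟩ := exists_isProbabilityMeasure_dTV_le μ (fun n => c ^ n) hpow
    fun n m hnm => by
      obtain ⟨k, rfl⟩ := Nat.exists_eq_add_of_le hnm
      have h := dTV_bind_iterate_le κ hκ (μ 0) (μ k) n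
      have hk : (fun m : Measure X => m.bind κ)^[n] (μ k) = μ (n + k) :=
        (Function.iterate_add_apply _ n k _).symm
      rw [hk] at h
      exact h.trans (mul_le_of_le_one_right (pow_nonneg hc n) (dTV_le_one _ _))
  have hstat : π.bind κ = π := by
    refine eq_of_dTV_le_zero (ge_of_tendsto' (f := fun n : ℕ => c * c ^ n + c ^ (n + 1))
      (x := Filter.atTop) ?_ fun n => ?_)
    · simpa using (hpow.const_mul c).add (hpow.comp (Filter.tendsto_add_atTop_nat 1))
    · have hsucc : μ (n + 1) = (μ n).bind κ := Function.iterate_succ_apply' _ n _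
      refine (dTV_triangle _ (μ (n + 1)) _).trans (add_le_add ?_ (hμπ (n + 1)))
      rw [hsucc, dTV_comm]
      exact (dTV_bind_le κ hκ _ _).trans (mul_le_mul_of_nonneg_left (hμπ n) hc)
  refine ⟨π, hπ, hstat, fun ν _ hνstat => ?_, fun ν _ n => ?_⟩
  · refine eq_of_dTV_le_zero ?_
    have h := dTV_bind_le κ hκ ν π
    rw [hstat, hνstat] at h
    nlinarith
  · have h := dTV_bind_iterate_le κ hκ ν π n
    rwa [Function.iterate_fixed (f := fun m : Measure X => m.bind κ) hstat n] at h

end Dobrushin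

/-- The coupling inequality. -/
theorem dTV_map_le {Ω X : Type*} [MeasurableSpace Ω] [MeasurableSpace X] (P : Measure Ω)
    [IsProbabilityMeasure P] {F G : Ω → X} (hF : Measurable F) (hG : Measurable G) {C : Set Ω}
    (hC : MeasurableSet C) (hFG : ∀ ω ∈ C, F ω = G ω) :
    dTV (P.map F) (P.map G) ≤ 1 - P.real C := by
  have key {F G : Ω → X} (hFG : ∀ ω ∈ C, F ω = G ω) (E : Set X) :
      P.real (F ⁻¹' E) - P.real (G ⁻¹' E) ≤ 1 - P.real C := by
    have hsub : F ⁻¹' E ⊆ G ⁻¹' E ∪ Cᶜ := fun ω hω => by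
      by_cases h : ω ∈ C
      · exact .inl (by simpa [← hFG ω h] using hω)
      · exact .inr h
    have := (measureReal_mono (μ := P) hsub).trans (measureReal_union_le _ _)
    rw [probReal_compl_eq_one_sub hC] at this
    linarith
  refine dTV_le_of_forall fun E hE => ?_
  rw [map_measureReal_apply hF hE, map_measureReal_apply hG hE]
  exact abs_sub_le_iff.2 ⟨key hFG E, key (fun ω h => (hFG ω h).symm) E⟩

/-- Common-proposal coupling bound for an accept/reject kernel: from state `x`
draw a latent `m ~ K x` and a proposal `y ~ ρ`, move to `T y` if `(m, y) ∈ A`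
and stay at `x` otherwise.  If `δ > 0` lower-bounds, uniformly in `x, x'`, the
probability that a common proposal is accepted from both latents, then
`dTV (Q x) (Q x') ≤ 1 − δ`, and the chain has a unique stationary probability
measure with geometric convergence at rate `1 − δ`. -/
theorem stmt_8 {X M Y : Type*} [MeasurableSpace X] [MeasurableSpace M]
    [MeasurableSpace Y] [Nonempty X]
    (K : Kernel X M) [IsMarkovKernel K]
    (ρ : Measure Y) [IsProbabilityMeasure ρ]
    (T : Y → X) (hT : Measurable T)
    (A : Set (M × Y)) (hA : MeasurableSet A)
    (Q : X → Measure X)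
    (hQ : ∀ x, Q x = ((K x).prod ρ).bind
      (fun p => if p ∈ A then Measure.dirac (T p.2) else Measure.dirac x))
    (δ : ℝ) (hδpos : 0 < δ)
    (hδ : ∀ x x' : X, δ ≤
      (∫⁻ m, ∫⁻ m', ρ {y | (m, y) ∈ A ∧ (m', y) ∈ A} ∂(K x') ∂(K x)).toReal) :
    (∀ x x' : X, dTV (Q x) (Q x') ≤ 1 - δ) ∧
    ∃ νs : Measure X, IsProbabilityMeasure νs ∧ νs.bind Q = νs ∧
      (∀ ν' : Measure X, IsProbabilityMeasure ν' → ν'.bind Q = ν' → ν' = νs) ∧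
      ∀ ν : Measure X, IsProbabilityMeasure ν → ∀ n : ℕ,
        dTV ((fun m' : Measure X => m'.bind Q)^[n] ν) νs ≤ (1 - δ) ^ n * dTV ν νs := by
  let g (x : X) (p : M × Y) : X := if p ∈ A then T p.2 else x
  have hg : Measurable fun q : X × (M × Y) => g q.1 q.2 :=
    Measurable.ite (measurable_snd hA) (hT.comp measurable_snd.snd) measurable_fst
  have hgx (x : X) : Measurable (g x) := hg.comp measurable_prodMk_left
  have hQmap (x : X) : Q x = ((K x).prod ρ).map (g x) := by
    rw [hQ, ← Measure.bind_dirac_eq_map _ (hgx x)]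
    congr 1
    funext p
    exact (apply_ite Measure.dirac _ _ _).symm
  let κ : Kernel X X :=
    { toFun := Q
      measurable' := Measure.measurable_of_measurable_coe _ fun E hE => by
        have h := Kernel.measurable_kernel_prodMk_left (κ := K ×ₖ Kernel.const X ρ) (hg hE)
        convert h using 2 with x
        rw [Kernel.prod_apply, Kernel.const_apply, hQmap, Measure.map_apply (hgx x) hE]
        rfl }
  have hκ (x : X) : κ x = Q x := rfl
  have : IsMarkovKernel κ := ⟨fun x => by
    rw [hκ, hQmap]
    exact Measure.isProbabilityMeasure_map (hgx x).aemeasurable⟩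
  have hTV (x x' : X) : dTV (Q x) (Q x') ≤ 1 - δ := by
    let P : Measure (M × M × Y) := (K x).prod ((K x').prod ρ)
    have hfst : Measurable fun ω : M × M × Y => (ω.1, ω.2.2) := by fun_prop
    have hmapfst : P.map (fun ω => (ω.1, ω.2.2)) = (K x).prod ρ := by
      have := Measure.map_prod_map (K x) ((K x').prod ρ) measurable_id measurable_snd
      rw [Measure.map_id, ← Measure.snd, Measure.snd_prod] at this
      exact this.symm
    have hmapsnd : P.map (fun ω => ω.2) = (K x').prod ρ := Measure.snd_prod
    let C : Set (M × M × Y) := {ω | (ω.1, ω.2.2) ∈ A ∧ ω.2 ∈ A}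
    have hC : MeasurableSet C := (hfst hA).inter (measurable_snd hA)
    have hPC : P C = ∫⁻ m, ∫⁻ m', ρ {y | (m, y) ∈ A ∧ (m', y) ∈ A} ∂(K x') ∂(K x) := by
      rw [Measure.prod_apply hC]
      refine lintegral_congr fun m => ?_
      rw [Measure.prod_apply (measurable_prodMk_left hC)]
      rfl
    have h := dTV_map_le P ((hgx x).comp hfst) ((hgx x').comp measurable_snd) hC
      fun ω hω => by simp [g, hω.1, hω.2]
    rw [← Measure.map_map (hgx x) hfst, ← Measure.map_map (hgx x') measurable_snd, hmapfst,
      hmapsnd, ← hQmap, ← hQmap, measureReal_def, hPC] at h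
    linarith [hδ x x']
  exact ⟨hTV, exists_stationary_of_dTV_le κ (by linarith) hTV⟩
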